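/- There is an absolute constant C such that the following holds. Let κ ≥ 1, let 0 < η ≤ 1, and let q, f, g be Schwartz functions on ℝ. Define F and G to be the inverse Fourier transforms of ξ ↦ (κ²+ξ²)^{−1/4}·f̂(ξ) and ξ ↦ (κ²+ξ²)^{−1/4}·ĝ(ξ), respectively. Then √κ·|∫_ℝ conj(F(x))·q(x)·G(x) dx| ≤ C·( (∫_{|ξ|>ηκ} |q̂(ξ)|² dξ)^{1/2} + √η·‖q‖_{L²} )·‖f‖_{L²}·‖g‖_{L²}. -/

import Mathlib

open MeasureTheory

/-- The Fourier transform with the paper's normalization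
`f̂(ξ) = (2π)^{−1/2} ∫ e^{−iξx} f(x) dx`. -/
noncomputable def ft (f : ℝ → ℂ) (ξ : ℝ) : ℂ :=
  (Real.sqrt (2 * Real.pi))⁻¹ • ∫ x : ℝ, Complex.exp (-(Complex.I * ξ * x)) * f x

/-- The inverse Fourier transform with the paper's normalization
`g^∨(x) = (2π)^{−1/2} ∫ e^{iξx} g(ξ) dξ`. -/
noncomputable def invft (g : ℝ → ℂ) (x : ℝ) : ℂ :=
  (Real.sqrt (2 * Real.pi))⁻¹ • ∫ ξ : ℝ, Complex.exp (Complex.I * ξ * x) * g ξ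

open scoped ENNReal FourierTransform SchwartzMap

theorem lintegral_mul_le_L2_mul_L2 {α : Type*} [MeasurableSpace α] {μ : Measure α}
    {f g : α → ℝ≥0∞} (hf : AEMeasurable f μ) (hg : AEMeasurable g μ) :
    ∫⁻ x, f x * g x ∂μ ≤
      (∫⁻ x, f x ^ 2 ∂μ) ^ (1 / 2 : ℝ) * (∫⁻ x, g x ^ 2 ∂μ) ^ (1 / 2 : ℝ) := by
  simpa using ENNReal.lintegral_mul_le_Lp_mul_Lq μ Real.HolderConjugate.two_two hf hg

theorem lintegral_lintegral_mul_mul_sub_le {A B Q : ℝ → ℝ≥0∞} (hA : Measurable A)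
    (hB : Measurable B) (hQ : Measurable Q) :
    ∫⁻ x, ∫⁻ t, A x * Q t * B (x - t) ≤
      (∫⁻ t, Q t) * ((∫⁻ x, A x ^ 2) ^ (1 / 2 : ℝ) * (∫⁻ x, B x ^ 2) ^ (1 / 2 : ℝ)) := by
  rw [lintegral_lintegral_swap (by unfold Function.uncurry; fun_prop),
    ← lintegral_mul_const _ hQ]
  refine lintegral_mono fun t => ?_
  calc ∫⁻ x, A x * Q t * B (x - t) = Q t * ∫⁻ x, A x * B (x - t) := by
        rw [← lintegral_const_mul _ (by fun_prop)]
        exact lintegral_congr fun x => by ring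
    _ ≤ _ := by
        gcongr
        refine (lintegral_mul_le_L2_mul_L2 (by fun_prop) (by fun_prop)).trans_eq ?_
        rw [lintegral_sub_right_eq_self (fun x => B x ^ 2) t]

theorem lintegral_lintegral_weight_mul_mul_sub_le {A B Q W : ℝ → ℝ≥0∞} (hA : Measurable A)
    (hB : Measurable B) (hQ : Measurable Q) (hW : Measurable W) :
    ∫⁻ x, ∫⁻ t, W x * A x * Q t * (W (x - t) * B (x - t)) ≤
      (∫⁻ x, W x ^ 4) ^ (1 / 2 : ℝ) * (∫⁻ t, Q t ^ 2) ^ (1 / 2 : ℝ) *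
        ((∫⁻ x, A x ^ 2) ^ (1 / 2 : ℝ) * (∫⁻ x, B x ^ 2) ^ (1 / 2 : ℝ)) := by
  have h_AB : ∫⁻ x, ∫⁻ t, (A x * B (x - t)) ^ 2 = (∫⁻ x, A x ^ 2) * ∫⁻ x, B x ^ 2 := by
    rw [← lintegral_mul_const _ (by fun_prop)]
    refine lintegral_congr fun x => ?_
    simp_rw [mul_pow]
    rw [lintegral_const_mul _ (by fun_prop), lintegral_sub_left_eq_self (fun x => B x ^ 2) x]
  have h_WQ : ∫⁻ x, ∫⁻ t, (W x * Q t * W (x - t)) ^ 2 ≤ (∫⁻ x, W x ^ 4) * ∫⁻ t, Q t ^ 2 := by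
    simp_rw [mul_pow]
    refine (lintegral_lintegral_mul_mul_sub_le (A := fun x => W x ^ 2) (B := fun x => W x ^ 2)
      (Q := fun t => Q t ^ 2) (by fun_prop) (by fun_prop) (by fun_prop)).trans_eq ?_
    rw [← ENNReal.rpow_add_of_nonneg _ _ (by norm_num) (by norm_num), mul_comm]
    norm_num [← pow_mul]
  calc ∫⁻ x, ∫⁻ t, W x * A x * Q t * (W (x - t) * B (x - t))
      = ∫⁻ z : ℝ × ℝ, (W z.1 * Q z.2 * W (z.1 - z.2)) * (A z.1 * B (z.1 - z.2)) := by
        rw [Measure.volume_eq_prod, lintegral_prod _ (by fun_prop)]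
        exact lintegral_congr fun x => lintegral_congr fun t => by ring
    _ ≤ _ := lintegral_mul_le_L2_mul_L2 (by fun_prop) (by fun_prop)
    _ = (∫⁻ x, ∫⁻ t, (W x * Q t * W (x - t)) ^ 2) ^ (1 / 2 : ℝ) *
          (∫⁻ x, ∫⁻ t, (A x * B (x - t)) ^ 2) ^ (1 / 2 : ℝ) := by
        rw [Measure.volume_eq_prod, lintegral_prod _ (by fun_prop), lintegral_prod _ (by fun_prop)]
    _ ≤ _ := by
        rw [h_AB, ← ENNReal.mul_rpow_of_nonneg (∫⁻ x, W x ^ 4) _ (by norm_num),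
          ← ENNReal.mul_rpow_of_nonneg (∫⁻ x, A x ^ 2) _ (by norm_num)]
        exact mul_le_mul' (ENNReal.rpow_le_rpow h_WQ (by norm_num)) le_rfl

theorem lintegral_lintegral_weight_le_of_split {A B Q W : ℝ → ℝ≥0∞} (hA : Measurable A)
    (hB : Measurable B) (hQ : Measurable Q) (hW : Measurable W) {c : ℝ≥0∞}
    (hWc : ∀ x, W x ≤ c) {s : Set ℝ} (hs : MeasurableSet s) :
    ∫⁻ x, ∫⁻ t, W x * A x * Q t * (W (x - t) * B (x - t)) ≤
      ((∫⁻ x, W x ^ 4) ^ (1 / 2 : ℝ) * (∫⁻ t in s, Q t ^ 2) ^ (1 / 2 : ℝ) +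
        c ^ 2 * (volume sᶜ ^ (1 / 2 : ℝ) * (∫⁻ t, Q t ^ 2) ^ (1 / 2 : ℝ))) *
        ((∫⁻ x, A x ^ 2) ^ (1 / 2 : ℝ) * (∫⁻ x, B x ^ 2) ^ (1 / 2 : ℝ)) := by
  have h_sq : ∫⁻ t, s.indicator Q t ^ 2 = ∫⁻ t in s, Q t ^ 2 := by
    rw [← lintegral_indicator hs]
    refine lintegral_congr fun t => ?_
    by_cases ht : t ∈ s <;> simp [ht]
  have h_one : ∫⁻ t, sᶜ.indicator Q t ≤
      volume sᶜ ^ (1 / 2 : ℝ) * (∫⁻ t, Q t ^ 2) ^ (1 / 2 : ℝ) := by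
    rw [lintegral_indicator hs.compl]
    calc ∫⁻ t in sᶜ, Q t = ∫⁻ t in sᶜ, 1 * Q t := by simp
      _ ≤ _ := lintegral_mul_le_L2_mul_L2 (by fun_prop) (by fun_prop)
      _ ≤ _ := by
        gcongr
        · simp
        · exact Measure.restrict_le_self
  have hQs := hQ.indicator hs
  have hQs' := hQ.indicator hs.compl
  calc ∫⁻ x, ∫⁻ t, W x * A x * Q t * (W (x - t) * B (x - t))
      = ∫⁻ x, ∫⁻ t, (W x * A x * s.indicator Q t * (W (x - t) * B (x - t)) +
          W x * A x * sᶜ.indicator Q t * (W (x - t) * B (x - t))) := by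
        refine lintegral_congr fun x => lintegral_congr fun t => ?_
        by_cases ht : t ∈ s <;> simp [ht]
    _ ≤ ∫⁻ x, ∫⁻ t, (W x * A x * s.indicator Q t * (W (x - t) * B (x - t)) +
          c ^ 2 * (A x * sᶜ.indicator Q t * B (x - t))) := by
        refine lintegral_mono fun x => lintegral_mono fun t => add_le_add le_rfl ?_
        calc W x * A x * sᶜ.indicator Q t * (W (x - t) * B (x - t))
            ≤ c * A x * sᶜ.indicator Q t * (c * B (x - t)) := by
              gcongr <;> exact hWc _
          _ = _ := by ring
    _ = (∫⁻ x, ∫⁻ t, W x * A x * s.indicator Q t * (W (x - t) * B (x - t))) +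
          c ^ 2 * ∫⁻ x, ∫⁻ t, A x * sᶜ.indicator Q t * B (x - t) := by
        rw [← lintegral_const_mul _ (Measurable.lintegral_prod_right (by fun_prop)),
          ← lintegral_add_left (Measurable.lintegral_prod_right (by fun_prop))]
        refine lintegral_congr fun x => ?_
        rw [← lintegral_const_mul _ (by fun_prop), ← lintegral_add_left (by fun_prop)]
    _ ≤ _ := by
        rw [add_mul, mul_assoc (c ^ 2), ← h_sq]
        gcongr
        · exact lintegral_lintegral_weight_mul_mul_sub_le hA hB hQs hW
        · exact (lintegral_lintegral_mul_mul_sub_le hA hB hQs').trans (by gcongr)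

theorem ft_eq_fourier (f : ℝ → ℂ) (ξ : ℝ) :
    ft f ξ = (Real.sqrt (2 * Real.pi))⁻¹ • 𝓕 f ((2 * Real.pi)⁻¹ * ξ) := by
  have h_pi : (Real.pi : ℂ) ≠ 0 := by exact_mod_cast Real.pi_ne_zero
  rw [ft, Real.fourier_eq']
  congr 2 with x
  rw [smul_eq_mul]
  congr 2
  simp
  field_simp

theorem invft_neg_two_pi_mul (g : ℝ → ℂ) (y : ℝ) :
    invft g (-(2 * Real.pi) * y) = (Real.sqrt (2 * Real.pi))⁻¹ • 𝓕 g y := by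
  rw [invft, Real.fourier_eq']
  congr 2 with x
  rw [smul_eq_mul]
  congr 2
  simp
  ring

theorem exists_schwartzMap_eq_ft (f : 𝓢(ℝ, ℂ)) : ∃ h : 𝓢(ℝ, ℂ), ⇑h = ft f := by
  have h_ne : (2 * Real.pi)⁻¹ ≠ 0 := by positivity
  refine ⟨(Real.sqrt (2 * Real.pi))⁻¹ • SchwartzMap.compCLMOfContinuousLinearEquiv ℝ
    (ContinuousLinearEquiv.unitsEquivAut ℝ (Units.mk0 _ h_ne)) (𝓕 f), ?_⟩
  ext ξ
  simp [ft_eq_fourier, SchwartzMap.fourier_coe, mul_comm]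

theorem fourier_ft (f : 𝓢(ℝ, ℂ)) (y : ℝ) :
    𝓕 (ft f) y = Real.sqrt (2 * Real.pi) • f (-(2 * Real.pi) * y) := by
  have h_scale : 𝓕 (fun ξ => 𝓕 (f : ℝ → ℂ) ((2 * Real.pi)⁻¹ * ξ)) y =
      (2 * Real.pi) • 𝓕 (𝓕 (f : ℝ → ℂ)) (2 * Real.pi * y) := by
    rw [Real.fourier_eq', Real.fourier_eq']
    have := Measure.integral_comp_mul_left (fun v : ℝ =>
      Complex.exp (↑(-2 * Real.pi * inner ℝ v (2 * Real.pi * y)) * Complex.I) •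
        𝓕 (f : ℝ → ℂ) v) (2 * Real.pi)⁻¹
    rw [inv_inv, abs_of_pos (by positivity)] at this
    rw [← this]
    congr 1 with v
    congr 4
    simp
    field_simp
  have h_inv : 𝓕 (𝓕 (f : ℝ → ℂ)) (2 * Real.pi * y) = f (-(2 * Real.pi) * y) := by
    have := Real.fourierInv_eq_fourier_neg (𝓕 (f : ℝ → ℂ)) (-(2 * Real.pi) * y)
    rw [neg_mul, neg_neg] at this
    rw [← this, ← SchwartzMap.fourier_coe, ← SchwartzMap.fourierInv_coe,
      FourierTransform.fourierInv_fourier_eq, neg_mul]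
  have h_ft : ft f = (Real.sqrt (2 * Real.pi))⁻¹ •
      fun ξ => 𝓕 (f : ℝ → ℂ) ((2 * Real.pi)⁻¹ * ξ) := funext (ft_eq_fourier f)
  have h_smul : 𝓕 (ft f) y = (Real.sqrt (2 * Real.pi))⁻¹ •
      𝓕 (fun ξ => 𝓕 (f : ℝ → ℂ) ((2 * Real.pi)⁻¹ * ξ)) y := by
    rw [h_ft, Real.fourier_eq', Real.fourier_eq', ← integral_smul]
    congr 1 with v
    simp only [Pi.smul_apply]
    rw [smul_comm]
  rw [h_smul, h_scale, h_inv, smul_smul]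
  congr 1
  rw [inv_mul_eq_div, Real.div_sqrt]

theorem integral_norm_sq_ft (f : 𝓢(ℝ, ℂ)) : ∫ ξ, ‖ft f ξ‖ ^ 2 = ∫ x, ‖f x‖ ^ 2 := by
  have h_pt : ∀ ξ, ‖ft f ξ‖ ^ 2 = (2 * Real.pi)⁻¹ * ‖𝓕 f ((2 * Real.pi)⁻¹ * ξ)‖ ^ 2 := fun ξ => by
    rw [ft_eq_fourier, norm_smul, mul_pow, SchwartzMap.fourier_coe, norm_inv, Real.norm_eq_abs,
      inv_pow, sq_abs, Real.sq_sqrt (by positivity)]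
  simp_rw [h_pt]
  rw [integral_const_mul, Measure.integral_comp_mul_left (fun ξ => ‖𝓕 f ξ‖ ^ 2),
    SchwartzMap.integral_norm_sq_fourier, inv_inv, abs_of_pos (by positivity), smul_eq_mul,
    inv_mul_cancel_left₀ (by positivity)]

theorem hasTemperateGrowth_sq_add_sq_rpow {κ : ℝ} (hκ : 0 < κ) (r : ℝ) :
    (fun ξ : ℝ => (κ ^ 2 + ξ ^ 2) ^ r).HasTemperateGrowth := by
  have h_comp : (fun ξ : ℝ => (κ ^ 2 + ξ ^ 2) ^ r) =
      fun ξ => (κ ^ 2) ^ r * (1 + ‖κ⁻¹ * ξ‖ ^ 2) ^ r := by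
    ext ξ
    rw [← Real.mul_rpow (by positivity) (by positivity), Real.norm_eq_abs, sq_abs]
    congr 1
    field_simp
  rw [h_comp]
  exact (Function.HasTemperateGrowth.const _).mul
    ((Function.hasTemperateGrowth_one_add_norm_sq_rpow ℝ r).comp
      ((Function.HasTemperateGrowth.const _).mul Function.HasTemperateGrowth.id'))

theorem integral_conj_invft_mul_mul_invft (Φ Γ q : 𝓢(ℝ, ℂ)) :
    ∫ x, starRingEnd ℂ (invft Φ x) * q x * invft Γ x =
      (Real.sqrt (2 * Real.pi))⁻¹ • ∫ ξ, starRingEnd ℂ (Φ ξ) * ∫ t, ft q t * Γ (ξ - t) := by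
  obtain ⟨Q, hQ⟩ := exists_schwartzMap_eq_ft q
  have h_pos : (0 : ℝ) < 2 * Real.pi := by positivity
  have h_sqrt : (Real.sqrt (2 * Real.pi) : ℂ) ≠ 0 := by
    exact_mod_cast (Real.sqrt_pos.2 h_pos).ne'
  have h_q : ∀ y, q (-(2 * Real.pi) * y) = (Real.sqrt (2 * Real.pi))⁻¹ • 𝓕 Q y := fun y => by
    rw [SchwartzMap.fourier_coe, hQ, fourier_ft, inv_smul_smul₀ (Real.sqrt_pos.2 h_pos).ne']
  have h_conv : ∀ ξ, ∫ t, ft q t * Γ (ξ - t) =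
      SchwartzMap.convolution (ContinuousLinearMap.mul ℂ ℂ) Q Γ ξ := fun ξ => by
    rw [SchwartzMap.convolution_apply, convolution_def, hQ]
    rfl
  have h_planch := SchwartzMap.integral_inner_fourier_fourier Φ
    (SchwartzMap.convolution (ContinuousLinearMap.mul ℂ ℂ) Q Γ)
  rw [SchwartzMap.fourier_convolution] at h_planch
  simp only [RCLike.inner_apply', SchwartzMap.pairing_apply_apply,
    ContinuousLinearMap.mul_apply'] at h_planch
  have h_subst := Measure.integral_comp_mul_left
    (fun x => starRingEnd ℂ (invft Φ x) * q x * invft Γ x) (-(2 * Real.pi))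
  simp_rw [invft_neg_two_pi_mul, h_q, ← SchwartzMap.fourier_coe] at h_subst
  rw [abs_inv, abs_neg, abs_of_pos h_pos, eq_inv_smul_iff₀ h_pos.ne'] at h_subst
  simp_rw [h_conv]
  rw [← h_subst, ← h_planch, ← integral_smul, ← integral_smul]
  congr 1 with y
  simp only [Complex.real_smul, map_mul, Complex.conj_ofReal, Complex.ofReal_inv, map_inv₀]
  rw [show ((2 * Real.pi : ℝ) : ℂ) = Real.sqrt (2 * Real.pi) * Real.sqrt (2 * Real.pi) by
    rw [← Complex.ofReal_mul, Real.mul_self_sqrt h_pos.le]]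
  field_simp

theorem integrable_norm_sq (f : 𝓢(ℝ, ℂ)) : Integrable fun x => ‖f x‖ ^ 2 :=
  (f.memLp 2).norm.integrable_sq

theorem lintegral_enorm_sq_rpow_half (f : 𝓢(ℝ, ℂ)) (s : Set ℝ) :
    (∫⁻ x in s, ‖f x‖ₑ ^ 2) ^ (1 / 2 : ℝ) =
      ENNReal.ofReal (Real.sqrt (∫ x in s, ‖f x‖ ^ 2)) := by
  rw [Real.sqrt_eq_rpow, ← ENNReal.ofReal_rpow_of_nonneg (by positivity) (by norm_num),
    ofReal_integral_eq_lintegral_ofReal (integrable_norm_sq f).integrableOn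
      (.of_forall fun x => by positivity)]
  simp_rw [← ofReal_norm, ENNReal.ofReal_pow (norm_nonneg _)]

theorem integral_univ_inv_sq_add_sq {κ : ℝ} (hκ : 0 < κ) :
    ∫ ξ : ℝ, (κ ^ 2 + ξ ^ 2)⁻¹ = Real.pi / κ := by
  have h_pt : ∀ ξ : ℝ, (κ ^ 2 + ξ ^ 2)⁻¹ = (κ ^ 2)⁻¹ * (1 + (ξ / κ) ^ 2)⁻¹ := fun ξ => by
    rw [← mul_inv]
    congr 1
    field_simp
  simp_rw [h_pt]
  rw [integral_const_mul, Measure.integral_comp_div (fun x => (1 + x ^ 2)⁻¹),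
    integral_univ_inv_one_add_sq, abs_of_pos hκ, smul_eq_mul]
  field_simp

theorem lintegral_sq_add_sq_rpow_neg_quarter_pow_four {κ : ℝ} (hκ : 0 < κ) :
    ∫⁻ ξ : ℝ, ENNReal.ofReal ((κ ^ 2 + ξ ^ 2) ^ (-(1 / 4) : ℝ)) ^ 4 =
      ENNReal.ofReal (Real.pi / κ) := by
  have h_int := integral_univ_inv_sq_add_sq hκ
  rw [← h_int, ofReal_integral_eq_lintegral_ofReal
    (.of_integral_ne_zero (h_int ▸ by positivity)) (.of_forall fun ξ => by positivity)]
  refine lintegral_congr fun ξ => ?_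
  rw [← ENNReal.ofReal_pow (by positivity), ← Real.rpow_mul_natCast (by positivity)]
  norm_num [Real.rpow_neg_one]

theorem sq_add_sq_rpow_neg_quarter_le {κ : ℝ} (hκ : 0 < κ) (ξ : ℝ) :
    (κ ^ 2 + ξ ^ 2) ^ (-(1 / 4) : ℝ) ≤ Real.sqrt κ⁻¹ := by
  calc (κ ^ 2 + ξ ^ 2) ^ (-(1 / 4) : ℝ) ≤ (κ ^ 2) ^ (-(1 / 4) : ℝ) :=
        Real.rpow_le_rpow_of_nonpos (by positivity) (by nlinarith) (by norm_num)
    _ = Real.sqrt κ⁻¹ := by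
        rw [← Real.rpow_natCast, ← Real.rpow_mul hκ.le, Real.sqrt_eq_rpow, Real.inv_rpow hκ.le,
          ← Real.rpow_neg hκ.le]
        norm_num

theorem exists_schwartzMap_eq_weight_smul_ft {κ : ℝ} (hκ : 0 < κ) (f : 𝓢(ℝ, ℂ)) :
    ∃ Φ : 𝓢(ℝ, ℂ), ⇑Φ = fun ξ => ((κ ^ 2 + ξ ^ 2) ^ (-(1 / 4) : ℝ) : ℝ) • ft f ξ := by
  obtain ⟨h, hh⟩ := exists_schwartzMap_eq_ft f
  refine ⟨SchwartzMap.smulLeftCLM ℂ (fun ξ : ℝ => (κ ^ 2 + ξ ^ 2) ^ (-(1 / 4) : ℝ)) h, ?_⟩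
  rw [SchwartzMap.smulLeftCLM_apply (hasTemperateGrowth_sq_add_sq_rpow hκ _), hh]

theorem lintegral_enorm_sq_ft_rpow_half (f : 𝓢(ℝ, ℂ)) :
    (∫⁻ ξ, ‖ft f ξ‖ₑ ^ 2) ^ (1 / 2 : ℝ) = ENNReal.ofReal (Real.sqrt (∫ x, ‖f x‖ ^ 2)) := by
  obtain ⟨h, hh⟩ := exists_schwartzMap_eq_ft f
  simpa [← integral_norm_sq_ft f, hh] using lintegral_enorm_sq_rpow_half h Set.univ

theorem norm_integral_conj_invft_mul_mul_invft_le {κ η : ℝ} (hκ : 0 < κ) (hη : 0 ≤ η)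
    (q f g : 𝓢(ℝ, ℂ)) :
    ‖∫ x : ℝ,
        (starRingEnd ℂ)
            (invft (fun ξ => ((κ ^ 2 + ξ ^ 2) ^ (-(1 / 4) : ℝ) : ℝ) • ft (⇑f) ξ) x) *
          q x *
          invft (fun ξ => ((κ ^ 2 + ξ ^ 2) ^ (-(1 / 4) : ℝ) : ℝ) • ft (⇑g) ξ) x‖ ≤
      (Real.sqrt (2 * Real.pi))⁻¹ *
        ((Real.sqrt (Real.pi / κ) *
            Real.sqrt (∫ ξ in {ξ : ℝ | η * κ < |ξ|}, ‖ft (⇑q) ξ‖ ^ 2) +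
          κ⁻¹ * (Real.sqrt (2 * (η * κ)) * Real.sqrt (∫ x : ℝ, ‖q x‖ ^ 2))) *
        (Real.sqrt (∫ x : ℝ, ‖f x‖ ^ 2) * Real.sqrt (∫ x : ℝ, ‖g x‖ ^ 2))) := by
  obtain ⟨Φ, hΦ⟩ := exists_schwartzMap_eq_weight_smul_ft hκ f
  obtain ⟨Γ, hΓ⟩ := exists_schwartzMap_eq_weight_smul_ft hκ g
  obtain ⟨Q, hQ⟩ := exists_schwartzMap_eq_ft q
  obtain ⟨F, hF⟩ := exists_schwartzMap_eq_ft f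
  obtain ⟨G, hG⟩ := exists_schwartzMap_eq_ft g
  have hs : MeasurableSet {ξ : ℝ | η * κ < |ξ|} :=
    measurableSet_lt measurable_const measurable_id.abs
  have h_vol : volume {ξ : ℝ | η * κ < |ξ|}ᶜ ^ (1 / 2 : ℝ) =
      ENNReal.ofReal (Real.sqrt (2 * (η * κ))) := by
    have h_Icc : {ξ : ℝ | η * κ < |ξ|}ᶜ = Set.Icc (-(η * κ)) (η * κ) := by
      ext ξ
      simp [abs_le]
    rw [h_Icc, Real.volume_Icc, ENNReal.ofReal_rpow_of_nonneg (by nlinarith [mul_nonneg hη hκ.le])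
      (by norm_num), Real.sqrt_eq_rpow]
    ring_nf
  have h_weight : ∀ ξ : ℝ, ENNReal.ofReal ((κ ^ 2 + ξ ^ 2) ^ (-(1 / 4) : ℝ)) ≤
      ENNReal.ofReal (Real.sqrt κ⁻¹) := fun ξ => ENNReal.ofReal_le_ofReal (sq_add_sq_rpow_neg_quarter_le hκ ξ)
  have h_enorm : ∀ (h : ℝ → ℂ) (ξ : ℝ), ‖((κ ^ 2 + ξ ^ 2) ^ (-(1 / 4) : ℝ) : ℝ) • h ξ‖ₑ =
      ENNReal.ofReal ((κ ^ 2 + ξ ^ 2) ^ (-(1 / 4) : ℝ)) * ‖h ξ‖ₑ := fun h ξ => by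
    rw [enorm_smul, Real.enorm_of_nonneg (by positivity)]
  have h_split := lintegral_lintegral_weight_le_of_split (A := fun ξ => ‖F ξ‖ₑ)
    (B := fun ξ => ‖G ξ‖ₑ) (Q := fun ξ => ‖Q ξ‖ₑ) F.continuous.measurable.enorm
    G.continuous.measurable.enorm Q.continuous.measurable.enorm (by fun_prop) h_weight hs
  have h_bound : ∫⁻ ξ, ∫⁻ t, ‖Φ ξ‖ₑ * ‖Q t‖ₑ * ‖Γ (ξ - t)‖ₑ ≤ ENNReal.ofReal
      ((Real.sqrt (Real.pi / κ) *
            Real.sqrt (∫ ξ in {ξ : ℝ | η * κ < |ξ|}, ‖ft (⇑q) ξ‖ ^ 2) +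
          κ⁻¹ * (Real.sqrt (2 * (η * κ)) * Real.sqrt (∫ x : ℝ, ‖q x‖ ^ 2))) *
        (Real.sqrt (∫ x : ℝ, ‖f x‖ ^ 2) * Real.sqrt (∫ x : ℝ, ‖g x‖ ^ 2))) := by
    rw [lintegral_sq_add_sq_rpow_neg_quarter_pow_four hκ, h_vol, lintegral_enorm_sq_rpow_half Q, hF, hG, hQ,
      lintegral_enorm_sq_ft_rpow_half, lintegral_enorm_sq_ft_rpow_half, lintegral_enorm_sq_ft_rpow_half,
      ENNReal.ofReal_rpow_of_nonneg (by positivity) (by norm_num), ← Real.sqrt_eq_rpow,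
      ← ENNReal.ofReal_pow (by positivity), Real.sq_sqrt (by positivity)] at h_split
    simp_rw [hΦ, hΓ, h_enorm, hQ]
    rw [ENNReal.ofReal_mul (by positivity), ENNReal.ofReal_add (by positivity) (by positivity)]
    simpa only [ENNReal.ofReal_mul, Real.sqrt_nonneg, inv_nonneg.2 hκ.le] using h_split
  rw [← hΦ, ← hΓ, integral_conj_invft_mul_mul_invft, norm_smul, norm_inv,
    Real.norm_of_nonneg (Real.sqrt_nonneg _), ← hQ]
  rw [← hQ] at h_bound
  gcongr
  rw [← ENNReal.ofReal_le_ofReal_iff (by positivity), ofReal_norm]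
  refine le_trans ?_ h_bound
  refine (enorm_integral_le_lintegral_enorm _).trans (lintegral_mono fun ξ => ?_)
  rw [enorm_mul, RCLike.enorm_conj]
  calc ‖Φ ξ‖ₑ * ‖∫ t, Q t * Γ (ξ - t)‖ₑ
      ≤ ‖Φ ξ‖ₑ * ∫⁻ t, ‖Q t * Γ (ξ - t)‖ₑ := by
        gcongr
        exact enorm_integral_le_lintegral_enorm _
    _ = ∫⁻ t, ‖Φ ξ‖ₑ * ‖Q t‖ₑ * ‖Γ (ξ - t)‖ₑ := by
        rw [← lintegral_const_mul' _ _ enorm_ne_top]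
        simp_rw [enorm_mul, mul_assoc]

/-- The quantitative core of Proposition 2.6 of the paper, in bilinear-form
version: `√κ ‖Λ(q)‖_op ≲ ‖q_{>ηκ}‖_{L²} + √η ‖q‖_{L²}`. -/
theorem sqrt_kappa_Lambda_op_bound :
    ∃ C : ℝ, 0 < C ∧ ∀ κ : ℝ, 1 ≤ κ → ∀ η : ℝ, 0 < η → η ≤ 1 →
      ∀ q f g : SchwartzMap ℝ ℂ,
      Real.sqrt κ *
        ‖∫ x : ℝ,
            (starRingEnd ℂ)
                (invft (fun ξ => ((κ ^ 2 + ξ ^ 2) ^ (-(1 / 4) : ℝ) : ℝ) • ft (⇑f) ξ) x) *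
              q x *
              invft (fun ξ => ((κ ^ 2 + ξ ^ 2) ^ (-(1 / 4) : ℝ) : ℝ) • ft (⇑g) ξ) x‖
        ≤ C * (Real.sqrt (∫ ξ in {ξ : ℝ | η * κ < |ξ|}, ‖ft (⇑q) ξ‖ ^ 2) +
              Real.sqrt η * Real.sqrt (∫ x : ℝ, ‖q x‖ ^ 2)) *
            Real.sqrt (∫ x : ℝ, ‖f x‖ ^ 2) * Real.sqrt (∫ x : ℝ, ‖g x‖ ^ 2) := by
  refine ⟨1, one_pos, fun κ hκ η hη _ q f g => ?_⟩
  have hκ₀ : 0 < κ := one_pos.trans_le hκ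
  refine (mul_le_mul_of_nonneg_left
    (norm_integral_conj_invft_mul_mul_invft_le hκ₀ hη.le q f g) (Real.sqrt_nonneg κ)).trans ?_
  set H := Real.sqrt (∫ ξ in {ξ : ℝ | η * κ < |ξ|}, ‖ft (⇑q) ξ‖ ^ 2)
  set N := Real.sqrt (∫ x : ℝ, ‖q x‖ ^ 2)
  have h_high : Real.sqrt κ * (Real.sqrt (2 * Real.pi))⁻¹ * Real.sqrt (Real.pi / κ) ≤ 1 := by
    rw [← Real.sqrt_inv, ← Real.sqrt_mul hκ₀.le, ← Real.sqrt_mul (by positivity), Real.sqrt_le_one]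
    field_simp
    norm_num
  have h_low : Real.sqrt κ * (Real.sqrt (2 * Real.pi))⁻¹ * (κ⁻¹ * Real.sqrt (2 * (η * κ))) ≤
      Real.sqrt η := by
    refine Real.le_sqrt_of_sq_le ?_
    rw [mul_pow, mul_pow, mul_pow, inv_pow, Real.sq_sqrt hκ₀.le, Real.sq_sqrt (by positivity),
      Real.sq_sqrt (by positivity)]
    field_simp
    linarith [Real.pi_gt_three]
  calc _ = (Real.sqrt κ * (Real.sqrt (2 * Real.pi))⁻¹ * Real.sqrt (Real.pi / κ) * H +
          Real.sqrt κ * (Real.sqrt (2 * Real.pi))⁻¹ * (κ⁻¹ * Real.sqrt (2 * (η * κ))) * N) *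
        (Real.sqrt (∫ x : ℝ, ‖f x‖ ^ 2) * Real.sqrt (∫ x : ℝ, ‖g x‖ ^ 2)) := by ring
    _ ≤ (1 * H + Real.sqrt η * N) *
        (Real.sqrt (∫ x : ℝ, ‖f x‖ ^ 2) * Real.sqrt (∫ x : ℝ, ‖g x‖ ^ 2)) := by gcongr
    _ = _ := by ring
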